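/- Let u : X → Λ be quasi-Leontief and S ⊆ X a comprehensive (downward closed) set. Then argmax(u; S) is nonempty if and only if S ∩ E(u; X) has a largest element x̄; in that case x̄ ∈ argmax(u; S) and every x ∈ argmax(u; S) satisfies x ≥ x̄. -/

import Mathlib

theorem quasiLeontief_argmax_iff_greatest_efficient
    {X Λ : Type*} [PartialOrder X] [LinearOrder Λ]
    (u : X → Λ)
    (hql : ∀ x : X, ∃ m : X, IsLeast {x' : X | u x ≤ u x'} m)
    (S : Set X) (hS : ∀ x x' : X, x' ∈ S → x ≤ x' → x ∈ S) :
    ({x ∈ S | ∀ y ∈ S, u y ≤ u x}.Nonempty ↔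
      ∃ xb : X, IsGreatest (S ∩ {x : X | ∀ x' : X, u x ≤ u x' → x ≤ x'}) xb) ∧
    (∀ xb : X, IsGreatest (S ∩ {x : X | ∀ x' : X, u x ≤ u x' → x ≤ x'}) xb →
      (xb ∈ S ∧ ∀ y ∈ S, u y ≤ u xb) ∧
      ∀ x ∈ S, (∀ y ∈ S, u y ≤ u x) → xb ≤ x) := by
  have efficient_of_isLeast : ∀ {y m : X}, IsLeast {x' : X | u y ≤ u x'} m →
      ∀ x' : X, u m ≤ u x' → m ≤ x' :=
    fun hm x' hx' => hm.2 (le_trans hm.1 hx')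
  have argmax_of_greatest : ∀ xb : X,
      IsGreatest (S ∩ {x : X | ∀ x' : X, u x ≤ u x' → x ≤ x'}) xb →
      xb ∈ S ∧ ∀ y ∈ S, u y ≤ u xb := by
    rintro xb ⟨⟨hxbS, hxbE⟩, hub⟩
    refine ⟨hxbS, fun y hy => ?_⟩
    obtain ⟨m, hm⟩ := hql y
    have hmy : m ≤ y := hm.2 (le_refl (u y))
    have hmxb : m ≤ xb := hub ⟨hS m y hy hmy, efficient_of_isLeast hm⟩
    by_contra! hlt
    have hlt' : u xb < u m := lt_of_lt_of_le hlt hm.1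
    exact hlt'.ne (congrArg u (le_antisymm (hxbE m hlt'.le) hmxb))
  refine ⟨⟨?_, fun ⟨xb, hxb⟩ => ⟨xb, argmax_of_greatest xb hxb⟩⟩, fun xb hxb =>
    ⟨argmax_of_greatest xb hxb, fun x _ hx => hxb.1.2 x (hx xb hxb.1.1)⟩⟩
  rintro ⟨x, hxS, hx⟩
  obtain ⟨m, hm⟩ := hql x
  exact ⟨m, ⟨hS m x hxS (hm.2 (le_refl (u x))), efficient_of_isLeast hm⟩,
    fun e he => he.2 m (le_trans (hx e he.1) hm.1)⟩
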